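/- Suppose either (i) p11 > p01 and β ≤ 1/((3−ε)·(p11 − p01)), or (ii) p01 > p11 and β ≤ 1/((5−2ε)·(p01 − p11)). Then for every horizon T ≥ 1 the difference function h_T(ω) = V_T(ω;u=1) − V_T(ω;u=0) is monotonically nondecreasing on [0,1]: for all ω ≤ ω' in [0,1], h_T(ω) ≤ h_T(ω'). -/

import Mathlib

/-- One-step belief update without observation: `T(ω) = ω·p11 + (1−ω)·p01`. -/
noncomputable def Tmap (p01 p11 ω : ℝ) : ℝ := ω * p11 + (1 - ω) * p01

/-- Belief update after a failed observation: `φ(ω) = εω/(εω + 1 − ω)`. -/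
noncomputable def phi (ε ω : ℝ) : ℝ := ε * ω / (ε * ω + 1 - ω)

/-- Finite-horizon value function `V_T` of the single-armed bandit with subsidy `m`:
`V_0 ≡ 0` and `V_T(ω) = max{V_T(ω;u=1), V_T(ω;u=0)}`. -/
noncomputable def Vfin (p01 p11 ε β m : ℝ) : ℕ → ℝ → ℝ
  | 0, _ => 0
  | T + 1, ω =>
      max ((1 - ε) * ω + β * ((1 - ε) * ω * Vfin p01 p11 ε β m T p11
            + (1 - (1 - ε) * ω) * Vfin p01 p11 ε β m T (Tmap p01 p11 (phi ε ω))))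
          (m + β * Vfin p01 p11 ε β m T (Tmap p01 p11 ω))


/-- Active-branch finite-horizon value `V_T(ω;u=1)` (meaningful for `T ≥ 1`). -/
noncomputable def VfinAct (p01 p11 ε β m : ℝ) (T : ℕ) (ω : ℝ) : ℝ :=
  (1 - ε) * ω + β * ((1 - ε) * ω * Vfin p01 p11 ε β m (T - 1) p11
    + (1 - (1 - ε) * ω) * Vfin p01 p11 ε β m (T - 1) (Tmap p01 p11 (phi ε ω)))

/-- Passive-branch finite-horizon value `V_T(ω;u=0)` (meaningful for `T ≥ 1`). -/
noncomputable def VfinPas (p01 p11 ε β m : ℝ) (T : ℕ) (ω : ℝ) : ℝ :=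
  m + β * Vfin p01 p11 ε β m (T - 1) (Tmap p01 p11 ω)

/-- All difference quotients of `f` on `[0,1]` lie in `[lo, hi]`. -/
def SlopeBetween (lo hi : ℝ) (f : ℝ → ℝ) : Prop :=
  ∀ x ∈ Set.Icc (0:ℝ) 1, ∀ y ∈ Set.Icc (0:ℝ) 1, x ≤ y →
    lo * (y - x) ≤ f y - f x ∧ f y - f x ≤ hi * (y - x)

theorem phi_denom_pos {ε ω : ℝ} (hε : 0 < ε) (hω : ω ∈ Set.Icc (0:ℝ) 1) :
    0 < ε * ω + 1 - ω := by
  obtain ⟨h0, h1⟩ := hω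
  rcases h1.lt_or_eq with h | rfl
  · nlinarith [mul_nonneg hε.le h0]
  · linarith

theorem phi_mem_Icc {ε ω : ℝ} (hε : 0 < ε) (hω : ω ∈ Set.Icc (0:ℝ) 1) :
    phi ε ω ∈ Set.Icc (0:ℝ) 1 := by
  have hq := phi_denom_pos hε hω
  refine ⟨div_nonneg (mul_nonneg hε.le hω.1) hq.le, (div_le_one hq).2 ?_⟩
  linarith [hω.2]

theorem denom_mul_phi {ε ω : ℝ} (hε : 0 < ε) (hω : ω ∈ Set.Icc (0:ℝ) 1) :
    (ε * ω + 1 - ω) * phi ε ω = ε * ω :=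
  mul_div_cancel₀ _ (phi_denom_pos hε hω).ne'

theorem phi_le_phi {ε x y : ℝ} (hε : 0 < ε) (hx : x ∈ Set.Icc (0:ℝ) 1)
    (hy : y ∈ Set.Icc (0:ℝ) 1) (hxy : x ≤ y) : phi ε x ≤ phi ε y := by
  unfold phi
  rw [div_le_div_iff₀ (phi_denom_pos hε hx) (phi_denom_pos hε hy)]
  nlinarith [mul_le_mul_of_nonneg_left hxy hε.le]

theorem Tmap_mem_Icc {p01 p11 ω : ℝ} (hp01 : p01 ∈ Set.Ioo (0:ℝ) 1)
    (hp11 : p11 ∈ Set.Ioo (0:ℝ) 1) (hω : ω ∈ Set.Icc (0:ℝ) 1) :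
    Tmap p01 p11 ω ∈ Set.Icc (0:ℝ) 1 := by
  obtain ⟨h0, h1⟩ := hω
  have h1' : 0 ≤ 1 - ω := by linarith
  unfold Tmap
  constructor
  · nlinarith [mul_nonneg h0 hp11.1.le, mul_nonneg h1' hp01.1.le]
  · nlinarith [mul_le_mul_of_nonneg_left hp11.2.le h0, mul_le_mul_of_nonneg_left hp01.2.le h1']

/-- Averaging `g` over the outcome of an observation preserves slope bounds. -/
theorem SlopeBetween.observe {ε lo hi : ℝ} {g : ℝ → ℝ} (hε : ε ∈ Set.Ioo (0:ℝ) 1)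
    (hg : SlopeBetween lo hi g) :
    SlopeBetween lo hi fun ω => (1 - ε) * ω * g 1 + (1 - (1 - ε) * ω) * g (phi ε ω) := by
  intro x hx y hy hxy
  have hφx := phi_mem_Icc hε.1 hx
  have hq := (phi_denom_pos hε.1 hy).le
  have hd : 0 ≤ (1 - ε) * (y - x) := mul_nonneg (by linarith [hε.2]) (by linarith)
  obtain ⟨l, u⟩ := hg _ hφx _ (phi_mem_Icc hε.1 hy) (phi_le_phi hε.1 hx hy hxy)
  obtain ⟨l', u'⟩ := hg _ hφx 1 (by simp) hφx.2
  have ex := denom_mul_phi hε.1 hx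
  have ey := denom_mul_phi hε.1 hy
  have split : (ε * y + 1 - y) * (phi ε y - phi ε x) + (1 - ε) * (y - x) * (1 - phi ε x)
      = y - x := by linear_combination ey - ex
  have L := add_le_add (mul_le_mul_of_nonneg_left l hq) (mul_le_mul_of_nonneg_left l' hd)
  have U := add_le_add (mul_le_mul_of_nonneg_left u hq) (mul_le_mul_of_nonneg_left u' hd)
  constructor
  · linear_combination L - lo * split
  · linear_combination U + hi * split

theorem VfinAct_succ (p01 p11 ε β m : ℝ) (T : ℕ) (ω : ℝ) :
    VfinAct p01 p11 ε β m (T + 1) ω = (1 - ε) * ω +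
      ((1 - ε) * ω * (β * Vfin p01 p11 ε β m T (Tmap p01 p11 1)) +
        (1 - (1 - ε) * ω) * (β * Vfin p01 p11 ε β m T (Tmap p01 p11 (phi ε ω)))) := by
  have h : Tmap p01 p11 1 = p11 := by simp [Tmap]
  rw [h, VfinAct, Nat.add_sub_cancel]
  ring

theorem Vfin_succ (p01 p11 ε β m : ℝ) (T : ℕ) (ω : ℝ) :
    Vfin p01 p11 ε β m (T + 1) ω =
      max (VfinAct p01 p11 ε β m (T + 1) ω) (VfinPas p01 p11 ε β m (T + 1) ω) := rfl

theorem SlopeBetween.max {lo hi : ℝ} {f g : ℝ → ℝ} (hf : SlopeBetween lo hi f)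
    (hg : SlopeBetween lo hi g) : SlopeBetween lo hi fun x => max (f x) (g x) := by
  intro x hx y hy hxy
  obtain ⟨l, u⟩ := hf x hx y hy hxy
  obtain ⟨l', u'⟩ := hg x hx y hy hxy
  beta_reduce
  constructor
  · rcases max_choice (f x) (g x) with h | h <;> rw [h]
    · linarith [le_max_left (f y) (g y)]
    · linarith [le_max_right (f y) (g y)]
  · rcases max_choice (f y) (g y) with h | h <;> rw [h]
    · linarith [le_max_left (f x) (g x)]
    · linarith [le_max_right (f x) (g x)]

theorem SlopeBetween.mono {lo lo' hi hi' : ℝ} {f : ℝ → ℝ} (hf : SlopeBetween lo hi f)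
    (hlo : lo' ≤ lo) (hhi : hi ≤ hi') : SlopeBetween lo' hi' f := by
  intro x hx y hy hxy
  have hd := sub_nonneg.2 hxy
  obtain ⟨l, u⟩ := hf x hx y hy hxy
  exact ⟨(mul_le_mul_of_nonneg_right hlo hd).trans l, u.trans (mul_le_mul_of_nonneg_right hhi hd)⟩

theorem slopeBetween_VfinAct {p01 p11 ε β m lo hi : ℝ} {T : ℕ} (hε : ε ∈ Set.Ioo (0:ℝ) 1)
    (hV : SlopeBetween lo hi fun ω => β * Vfin p01 p11 ε β m T (Tmap p01 p11 ω)) :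
    SlopeBetween (1 - ε + lo) (1 - ε + hi) (VfinAct p01 p11 ε β m (T + 1)) := by
  intro x hx y hy hxy
  obtain ⟨l, u⟩ := hV.observe hε x hx y hy hxy
  simp only [VfinAct_succ]
  constructor <;> linarith

theorem slopeBetween_VfinPas {p01 p11 ε β m lo hi : ℝ} {T : ℕ}
    (hV : SlopeBetween lo hi fun ω => β * Vfin p01 p11 ε β m T (Tmap p01 p11 ω)) :
    SlopeBetween lo hi (VfinPas p01 p11 ε β m (T + 1)) := by
  intro x hx y hy hxy
  obtain ⟨l, u⟩ := hV x hx y hy hxy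
  simp only [VfinPas, Nat.add_sub_cancel]
  constructor <;> linarith

theorem slopeBetween_Vfin_comp_Tmap {p01 p11 ε β m lo hi : ℝ} (hε : ε ∈ Set.Ioo (0:ℝ) 1)
    (hlo : lo ≤ 0) (hhi : 0 ≤ hi)
    (hcomp : ∀ f : ℝ → ℝ, SlopeBetween lo (1 - ε + hi) f →
      SlopeBetween lo hi fun ω => β * f (Tmap p01 p11 ω)) (T : ℕ) :
    SlopeBetween lo hi fun ω => β * Vfin p01 p11 ε β m T (Tmap p01 p11 ω) := by
  induction T with
  | zero =>
    intro x _ y _ hxy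
    have hd := sub_nonneg.2 hxy
    simpa [Vfin] using And.intro (mul_nonpos_of_nonpos_of_nonneg hlo hd) (mul_nonneg hhi hd)
  | succ T ih =>
    refine hcomp _ ?_
    simp only [funext (Vfin_succ p01 p11 ε β m T)]
    exact ((slopeBetween_VfinAct hε ih).mono (by linarith [hε.2]) le_rfl).max
      ((slopeBetween_VfinPas ih).mono le_rfl (by linarith [hε.2]))

theorem SlopeBetween.comp_Tmap_of_le {p01 p11 β lo hi : ℝ} {f : ℝ → ℝ}
    (hp01 : p01 ∈ Set.Ioo (0:ℝ) 1) (hp11 : p11 ∈ Set.Ioo (0:ℝ) 1) (hβ : 0 ≤ β)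
    (hle : p01 ≤ p11) (hf : SlopeBetween lo hi f) :
    SlopeBetween (β * (p11 - p01) * lo) (β * (p11 - p01) * hi)
      fun ω => β * f (Tmap p01 p11 ω) := by
  intro x hx y hy hxy
  have e : Tmap p01 p11 y - Tmap p01 p11 x = (p11 - p01) * (y - x) := by unfold Tmap; ring
  have h : 0 ≤ (p11 - p01) * (y - x) := mul_nonneg (by linarith) (by linarith)
  obtain ⟨l, u⟩ := hf _ (Tmap_mem_Icc hp01 hp11 hx) _ (Tmap_mem_Icc hp01 hp11 hy) (by linarith)
  rw [e] at l u
  constructor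
  · linear_combination β * l
  · linear_combination β * u

theorem SlopeBetween.comp_Tmap_of_ge {p01 p11 β lo hi : ℝ} {f : ℝ → ℝ}
    (hp01 : p01 ∈ Set.Ioo (0:ℝ) 1) (hp11 : p11 ∈ Set.Ioo (0:ℝ) 1) (hβ : 0 ≤ β)
    (hge : p11 ≤ p01) (hf : SlopeBetween lo hi f) :
    SlopeBetween (-(β * (p01 - p11) * hi)) (-(β * (p01 - p11) * lo))
      fun ω => β * f (Tmap p01 p11 ω) := by
  intro x hx y hy hxy
  have e : Tmap p01 p11 x - Tmap p01 p11 y = (p01 - p11) * (y - x) := by unfold Tmap; ring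
  have h : 0 ≤ (p01 - p11) * (y - x) := mul_nonneg (by linarith) (by linarith)
  obtain ⟨l, u⟩ := hf _ (Tmap_mem_Icc hp01 hp11 hy) _ (Tmap_mem_Icc hp01 hp11 hx) (by linarith)
  rw [e] at l u
  constructor
  · linear_combination β * u
  · linear_combination β * l

/-- Under the stated conditions on `β`, the difference
`h_T(ω) = V_T(ω;u=1) − V_T(ω;u=0)` is monotonically nondecreasing on `[0,1]`
for every horizon `T ≥ 1`. -/
theorem diff_act_pas_monotone (p01 p11 ε β m : ℝ)
    (hp01 : p01 ∈ Set.Ioo (0:ℝ) 1) (hp11 : p11 ∈ Set.Ioo (0:ℝ) 1)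
    (hne : p01 ≠ p11) (hε : ε ∈ Set.Ioo (0:ℝ) 1) (hβ : β ∈ Set.Ioo (0:ℝ) 1)
    (hcond : (p01 < p11 ∧ β ≤ 1 / ((3 - ε) * (p11 - p01))) ∨
             (p11 < p01 ∧ β ≤ 1 / ((5 - 2 * ε) * (p01 - p11)))) :
    ∀ T : ℕ, 1 ≤ T → ∀ ω ∈ Set.Icc (0:ℝ) 1, ∀ ω' ∈ Set.Icc (0:ℝ) 1, ω ≤ ω' →
      VfinAct p01 p11 ε β m T ω - VfinPas p01 p11 ε β m T ω
        ≤ VfinAct p01 p11 ε β m T ω' - VfinPas p01 p11 ε β m T ω' := by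
  obtain ⟨lo, hi, hlo, hhi, hgap, hcomp⟩ : ∃ lo hi : ℝ, lo ≤ 0 ∧ 0 ≤ hi ∧ hi - lo ≤ 1 - ε ∧
      ∀ f : ℝ → ℝ, SlopeBetween lo (1 - ε + hi) f →
        SlopeBetween lo hi fun ω => β * f (Tmap p01 p11 ω) := by
    have hε' : 0 < 1 - ε := by linarith [hε.2]
    rcases hcond with ⟨hlt, hb⟩ | ⟨hlt, hb⟩
    · have hd : 0 < p11 - p01 := by linarith
      rw [le_div_iff₀ (mul_pos (by linarith) hd)] at hb
      have hc : 0 < β * (p11 - p01) := mul_pos hβ.1 hd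
      have hx : β * (p11 - p01) ≤ 1 / 2 := by nlinarith [mul_pos hc hε']
      exact ⟨0, 1 - ε, le_rfl, hε'.le, by linarith, fun f hf =>
        (hf.comp_Tmap_of_le hp01 hp11 hβ.1.le hlt.le).mono (by simp)
          (by nlinarith [mul_le_mul_of_nonneg_right hx hε'.le])⟩
    · have hd : 0 < p01 - p11 := by linarith
      rw [le_div_iff₀ (mul_pos (by linarith) hd)] at hb
      have hc : 0 < β * (p01 - p11) := mul_pos hβ.1 hd
      have hx : β * (p01 - p11) ≤ 1 / 3 := by nlinarith [mul_pos hc hε']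
      exact ⟨-((1 - ε) / 2), (1 - ε) / 2, by linarith, by linarith, by linarith, fun f hf =>
        (hf.comp_Tmap_of_ge hp01 hp11 hβ.1.le hlt.le).mono
          (by nlinarith [mul_le_mul_of_nonneg_right hx hε'.le])
          (by nlinarith [mul_le_mul_of_nonneg_right hx hε'.le])⟩
  intro T hT x hx y hy hxy
  obtain ⟨T, rfl⟩ := Nat.exists_eq_add_of_le' hT
  have hV := slopeBetween_Vfin_comp_Tmap (m := m) hε hlo hhi hcomp T
  have hA := (slopeBetween_VfinAct hε hV x hx y hy hxy).1
  have hP := (slopeBetween_VfinPas hV x hx y hy hxy).2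
  nlinarith [mul_nonneg (sub_nonneg.2 hgap) (sub_nonneg.2 hxy)]
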